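/- Let μ be a left Haar measure on SL(2,ℝ), fix s₀ ∈ (1/2, 1], and for T ≥ 1 define f_T : SL(2,ℝ) → ℝ by f_T(g) = e^{(s₀−1)·dist(g•i, i)} if dist(g•i, i) ≤ T and f_T(g) = 0 otherwise. Then there exists C > 0, depending only on s₀ and μ, such that for every T ≥ 1 and every g ∈ SL(2,ℝ): (i) ∫ f_T(h)·f_T(g⁻¹h) dμ(h) ≤ C·e^{(2s₀−1)T}·e^{−dist(g•i, i)/2}, and (ii) ∫ f_T(h)·f_T(g⁻¹h) dμ(h) = 0 whenever dist(g•i, i) > 2T. -/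

import Mathlib

open scoped MatrixGroups ENNReal
open UpperHalfPlane MeasureTheory

noncomputable section

instance : TopologicalSpace SL(2, ℝ) :=
  TopologicalSpace.induced ((↑) : SL(2, ℝ) → Matrix (Fin 2) (Fin 2) ℝ) inferInstance

instance : MeasurableSpace SL(2, ℝ) := borel _

instance : BorelSpace SL(2, ℝ) := ⟨rfl⟩

instance sx_topgrp : IsTopologicalGroup SL(2, ℝ) := Matrix.SpecialLinearGroup.topologicalGroup
instance sx_contsmul : ContinuousSMul SL(2, ℝ) ℍ := UpperHalfPlane.instContinuousSMulSL2R
lemma sx_proper : IsProperMap fun g : SL(2, ℝ) ↦ g • I := UpperHalfPlane.isProperMap_smul_I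

/-- The function sqrt of one plus v squared. -/
def sxA (v : ℝ) : ℝ := √(1 + v ^ 2)

lemma sxA_sq (v : ℝ) : sxA v ^ 2 = 1 + v ^ 2 := Real.sq_sqrt (by positivity)
lemma sxA_pos (v : ℝ) : 0 < sxA v := Real.sqrt_pos.mpr (by positivity)
lemma sxA_one_le (v : ℝ) : 1 ≤ sxA v := by
  have := sxA_sq v; have := sxA_pos v; nlinarith [sq_nonneg v]
lemma sxA_abs_le (v : ℝ) : |v| ≤ sxA v := by
  apply Real.abs_le_sqrt; linarith
lemma sxA_cont : Continuous sxA := by unfold sxA; fun_prop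

/-- Fermi coordinates around the imaginary axis. -/
def sxP (x : ℝ × ℝ) : ℍ :=
  UpperHalfPlane.mk ⟨Real.exp x.1 * x.2 / sxA x.2, Real.exp x.1 / sxA x.2⟩
    (div_pos (Real.exp_pos _) (sxA_pos _))

lemma sxP_re (x : ℝ × ℝ) : (sxP x).re = Real.exp x.1 * x.2 / sxA x.2 := rfl
lemma sxP_im (x : ℝ × ℝ) : (sxP x).im = Real.exp x.1 / sxA x.2 := rfl

lemma sxP_cont : Continuous sxP := by
  rw [UpperHalfPlane.isOpenEmbedding_coe.isInducing.continuous_iff]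
  have h : UpperHalfPlane.coe ∘ sxP = fun x : ℝ × ℝ =>
      Complex.equivRealProdCLM.symm (Real.exp x.1 * x.2 / sxA x.2, Real.exp x.1 / sxA x.2) := by
    funext x
    apply Complex.ext <;> simp [sxP]
  rw [h]
  have := sxA_cont
  have h0 : ∀ x : ℝ × ℝ, sxA x.2 ≠ 0 := fun x => (sxA_pos _).ne'
  fun_prop (disch := exact h0 _)

lemma sxP_cosh (x y : ℝ × ℝ) : Real.cosh (dist (sxP x) (sxP y)) =
    sxA x.2 * sxA y.2 * Real.cosh (x.1 - y.1) - x.2 * y.2 := by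
  rw [cosh_dist', sxP_re, sxP_im, sxP_re, sxP_im, Real.cosh_eq, neg_sub, Real.exp_sub, Real.exp_sub]
  have h1 := sxA_sq x.2
  have h2 := sxA_sq y.2
  have := sxA_pos x.2
  have := sxA_pos y.2
  have := Real.exp_pos x.1
  have := Real.exp_pos y.1
  field_simp
  linear_combination (sxA y.2 ^ 2 * Real.exp x.1 ^ 2) * (-h1) + (sxA x.2 ^ 2 * Real.exp y.1 ^ 2) * (-h2)

lemma sxP_surj (z : ℍ) : ∃ x, sxP x = z := by
  have hy := z.im_pos
  have hp : 0 < z.re ^ 2 + z.im ^ 2 := by positivity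
  refine ⟨(Real.log (√(z.re ^ 2 + z.im ^ 2)), z.re / z.im), ?_⟩
  have hA : sxA (z.re / z.im) = √(z.re ^ 2 + z.im ^ 2) / z.im := by
    have e : 1 + (z.re / z.im) ^ 2 = (z.re ^ 2 + z.im ^ 2) / z.im ^ 2 := by
      field_simp
      ring
    rw [sxA, e, Real.sqrt_div hp.le, Real.sqrt_sq hy.le]
  have hs : 0 < √(z.re ^ 2 + z.im ^ 2) := Real.sqrt_pos.mpr hp
  apply UpperHalfPlane.ext
  apply Complex.ext
  · change (sxP _).re = z.re
    rw [sxP_re]; simp only [hA, Real.exp_log hs]; field_simp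
  · change (sxP _).im = z.im
    rw [sxP_im]; simp only [hA, Real.exp_log hs]; field_simp

lemma sxP_zero : sxP (0, 0) = I := by
  apply UpperHalfPlane.ext
  apply Complex.ext <;> simp [sxP, sxA]

lemma sx_box (x y : ℝ × ℝ) (h1 : |x.1 - y.1| ≤ 1 / (2 * sxA y.2))
    (h2 : |x.2 - y.2| ≤ sxA y.2 / 2) : dist (sxP x) (sxP y) ≤ 3 := by
  set a := sxA x.2
  set b := sxA y.2
  have ha : 0 < a := sxA_pos _
  have hb : 1 ≤ b := sxA_one_le _
  have ha2 : a ^ 2 = 1 + x.2 ^ 2 := sxA_sq _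
  have hb2 : b ^ 2 = 1 + y.2 ^ 2 := sxA_sq _
  have hyb : |y.2| ≤ b := sxA_abs_le _
  have hxb : |x.2| ≤ 3 / 2 * b := by
    have := abs_add_le (x.2 - y.2) y.2
    simp at this; linarith
  have hab : a ≤ 2 * b + 1 := by
    have : x.2 ^ 2 ≤ (3 / 2 * b) ^ 2 := sq_le_sq' (by linarith [neg_abs_le x.2]) (by linarith [le_abs_self x.2])
    nlinarith
  have hab : a ≤ 3 * b := by linarith
  -- cosh bound
  have hc : Real.cosh (x.1 - y.1) ≤ 1 + (x.1 - y.1) ^ 2 := by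
    have h3 : |x.1 - y.1| ≤ 1 := h1.trans (by rw [div_le_one (by positivity)]; linarith)
    have e1 := Real.abs_exp_sub_one_sub_id_le h3
    have e2 := Real.abs_exp_sub_one_sub_id_le (x := -(x.1 - y.1)) (by rwa [abs_neg])
    rw [Real.cosh_eq]
    have := (abs_le.mp e1).2
    have := (abs_le.mp e2).2
    nlinarith
  have hd : (x.1 - y.1) ^ 2 * b ^ 2 ≤ 1 / 4 := by
    have : |x.1 - y.1| * b ≤ 1 / 2 := by
      calc _ ≤ 1 / (2 * b) * b := by gcongr
        _ = 1 / 2 := by field_simp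
    rw [← sq_abs, ← mul_pow]
    have h0 : 0 ≤ |x.1 - y.1| * b := by positivity
    nlinarith
  have hv : a * b - x.2 * y.2 ≤ 3 / 2 + 1 := by
    have hv2 : (x.2 - y.2) ^ 2 ≤ b ^ 2 / 4 := by
      rw [← sq_abs]; nlinarith [abs_nonneg (x.2 - y.2)]
    have hxy : b ^ 2 / 2 ≤ 1 + x.2 * y.2 := by
      have : |(x.2 - y.2) * y.2| ≤ b / 2 * b := by
        rw [abs_mul]; gcongr
      have := (abs_le.mp this).1
      nlinarith
    have hq : (a * b) ^ 2 = (1 + x.2 * y.2) ^ 2 + (x.2 - y.2) ^ 2 := by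
      rw [mul_pow, ha2, hb2]; ring
    have : a * b ≤ 1 + x.2 * y.2 + 1 := by
      apply le_of_sq_le_sq _ (by nlinarith)
      nlinarith
    linarith
  have hcosh : Real.cosh (dist (sxP x) (sxP y)) ≤ Real.cosh 3 := by
    rw [sxP_cosh]
    have t1 : a * b * Real.cosh (x.1 - y.1) ≤ a * b * (1 + (x.1 - y.1) ^ 2) := by gcongr
    have t2 : a * b * (x.1 - y.1) ^ 2 ≤ 3 / 4 := by
      calc _ ≤ 3 * b * b * (x.1 - y.1) ^ 2 := by gcongr
        _ ≤ _ := by nlinarith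
    have t3 : (13:ℝ) / 4 ≤ Real.cosh 3 := by
      rw [Real.cosh_eq]
      have := Real.quadratic_le_exp_of_nonneg (x := 3) (by norm_num)
      have := Real.exp_pos (-3)
      linarith
    linarith
  rw [Real.cosh_le_cosh, abs_of_nonneg dist_nonneg] at hcosh
  simpa using hcosh

lemma sx_vol (z : ℍ) : 1 ≤ (volume : Measure (ℝ × ℝ)) {x | dist (sxP x) z ≤ 3} := by
  obtain ⟨y, rfl⟩ := sxP_surj z
  have hb := sxA_pos y.2
  calc (1 : ℝ≥0∞) = volume (Set.Icc (y.1 - 1 / (2 * sxA y.2)) (y.1 + 1 / (2 * sxA y.2)) ×ˢ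
        Set.Icc (y.2 - sxA y.2 / 2) (y.2 + sxA y.2 / 2)) := by
        rw [Measure.volume_eq_prod, Measure.prod_prod, Real.volume_Icc, Real.volume_Icc,
          ← ENNReal.ofReal_mul (by ring_nf; positivity)]
        rw [eq_comm, ENNReal.ofReal_eq_one]; field_simp; ring
    _ ≤ _ := by
      apply measure_mono
      rintro x ⟨h1, h2⟩
      apply sx_box
      · rw [abs_le]; constructor <;> linarith [h1.1, h1.2]
      · rw [abs_le]; constructor <;> linarith [h2.1, h2.2]

/-- comparison of measures -/
lemma sx_compare (ν : Measure ℍ) [SFinite ν] (N : ℝ≥0∞) (hNt : N ≠ ⊤)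
    (hN : ∀ z, ν (Metric.closedBall z 3) ≤ N) (F F' : ℍ → ℝ≥0∞) (hF : Measurable F)
    (hFF : ∀ z w, dist z w ≤ 3 → F z ≤ F' w) :
    ∫⁻ z, F z ∂ν ≤ N * ∫⁻ x, F' (sxP x) := by
  have hP := sxP_cont.measurable
  have hS : MeasurableSet {p : ℍ × (ℝ × ℝ) | dist (sxP p.2) p.1 ≤ 3} :=
    measurableSet_le ((hP.comp measurable_snd).dist measurable_fst) measurable_const
  have hS1 : ∀ z, MeasurableSet {x : ℝ × ℝ | dist (sxP x) z ≤ 3} := fun z =>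
    measurableSet_le (hP.dist measurable_const) measurable_const
  have hS2 : ∀ x, MeasurableSet {z : ℍ | dist (sxP x) z ≤ 3} := fun x =>
    measurableSet_le (measurable_const.dist measurable_id) measurable_const
  calc ∫⁻ z, F z ∂ν ≤ ∫⁻ z, F z * volume {x | dist (sxP x) z ≤ 3} ∂ν := by
        apply lintegral_mono; intro z
        exact le_mul_of_one_le_right' (sx_vol z)
    _ = ∫⁻ z, ∫⁻ (x : ℝ × ℝ), {p : ℍ × (ℝ × ℝ) | dist (sxP p.2) p.1 ≤ 3}.indicator (fun p => F p.1) (z, x) ∂volume ∂ν := by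
        apply lintegral_congr; intro z
        rw [← setLIntegral_const, ← lintegral_indicator (hS1 z)]
        rfl
    _ = ∫⁻ x, ∫⁻ z, {p : ℍ × (ℝ × ℝ) | dist (sxP p.2) p.1 ≤ 3}.indicator (fun p => F p.1) (z, x) ∂ν := by
        apply lintegral_lintegral_swap
        exact ((hF.comp measurable_fst).indicator hS).aemeasurable
    _ ≤ ∫⁻ x, N * F' (sxP x) := by
        apply lintegral_mono; intro x
        calc _ ≤ ∫⁻ z, (Metric.closedBall (sxP x) 3).indicator (fun _ => F' (sxP x)) z ∂ν := by
              apply lintegral_mono; intro z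
              simp only [Set.indicator, Set.mem_ofPred_eq, Metric.mem_closedBall]
              rw [dist_comm z]
              split_ifs with h
              · exact hFF _ _ (by rwa [dist_comm])
              · exact le_rfl
          _ = F' (sxP x) * ν (Metric.closedBall (sxP x) 3) := by
              rw [lintegral_indicator Metric.isClosed_closedBall.measurableSet, setLIntegral_const]
          _ ≤ _ := by rw [mul_comm]; exact mul_le_mul_left (hN _) _
    _ = N * ∫⁻ x, F' (sxP x) := lintegral_const_mul' _ _ hNt

lemma sx_vint (c M : ℝ) (hc : 0 < c) (hc1 : c ≤ 1) (hM : 0 ≤ M) :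
    ∫⁻ v, (if sxA v ≤ M then ENNReal.ofReal (sxA v ^ (c - 1)) else 0) ≤
      ENNReal.ofReal (2 / c * M ^ c) := by
  have h_integ : IntegrableOn (fun v : ℝ => v ^ (c - 1)) (Set.Ioc 0 M) := by
    have := intervalIntegral.intervalIntegrable_rpow' (a := 0) (b := M) (r := c - 1) (by linarith)
    rwa [intervalIntegrable_iff_integrableOn_Ioc_of_le hM] at this
  have hhalf : ∫⁻ v in Set.Ioi (0:ℝ), (if sxA v ≤ M then ENNReal.ofReal (sxA v ^ (c - 1)) else 0) ≤
      ENNReal.ofReal (M ^ c / c) := by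
    calc _ ≤ ∫⁻ v in Set.Ioi (0:ℝ), (Set.Ioc 0 M).indicator (fun v => ENNReal.ofReal (v ^ (c - 1))) v := by
          apply setLIntegral_mono' measurableSet_Ioi
          intro v hv
          have hv : 0 < v := hv
          have hvA : v ≤ sxA v := (le_abs_self v).trans (sxA_abs_le v)
          split_ifs with h
          · rw [Set.indicator_of_mem (show v ∈ Set.Ioc 0 M from ⟨hv, hvA.trans h⟩)]
            exact ENNReal.ofReal_le_ofReal (Real.rpow_le_rpow_of_nonpos hv hvA (by linarith))
          · exact zero_le
      _ ≤ ∫⁻ v, (Set.Ioc 0 M).indicator (fun v => ENNReal.ofReal (v ^ (c - 1))) v :=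
          setLIntegral_le_lintegral _ _
      _ = ∫⁻ v in Set.Ioc 0 M, ENNReal.ofReal (v ^ (c - 1)) := lintegral_indicator measurableSet_Ioc _
      _ = ENNReal.ofReal (∫ v in Set.Ioc 0 M, v ^ (c - 1)) := by
          rw [ofReal_integral_eq_lintegral_ofReal h_integ]
          exact (ae_restrict_iff' measurableSet_Ioc).mpr
            (Filter.Eventually.of_forall fun v hv => Real.rpow_nonneg hv.1.le _)
      _ = ENNReal.ofReal (M ^ c / c) := by
          rw [← intervalIntegral.integral_of_le hM, integral_rpow (Or.inl (by linarith))]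
          simp [Real.zero_rpow hc.ne']
  have hneg : ∫⁻ v in Set.Iio (0:ℝ), (if sxA v ≤ M then ENNReal.ofReal (sxA v ^ (c - 1)) else 0) =
      ∫⁻ v in Set.Ioi (0:ℝ), (if sxA v ≤ M then ENNReal.ofReal (sxA v ^ (c - 1)) else 0) := by
    have := (Measure.measurePreserving_neg (volume : Measure ℝ)).setLIntegral_comp_preimage_emb
      (MeasurableEquiv.neg ℝ).measurableEmbedding
      (fun v => (if sxA v ≤ M then ENNReal.ofReal (sxA v ^ (c - 1)) else 0)) (Set.Ioi 0)
    rw [← this]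
    have e : ∀ v, sxA (-v) = sxA v := by intro v; simp [sxA]
    simp [e]
  rw [← lintegral_add_compl _ (measurableSet_Ioi (a := (0:ℝ))), Set.compl_Ioi,
    setLIntegral_congr Iio_ae_eq_Iic.symm, hneg]
  calc _ ≤ ENNReal.ofReal (M ^ c / c) + ENNReal.ofReal (M ^ c / c) := add_le_add hhalf hhalf
    _ = _ := by
      rw [← ENNReal.ofReal_add (by positivity) (by positivity)]
      congr 1; ring

lemma sx_logbound (u v r : ℝ) (hr : 0 ≤ r) (h : Real.cosh r = sxA v * Real.cosh u) :
    Real.log (sxA v) + |u| ≤ r + 1 := by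
  have h1 : Real.cosh r ≤ Real.exp r := by
    rw [Real.cosh_eq]; have := Real.exp_le_exp.mpr (show -r ≤ r by linarith); linarith
  have h2 : Real.exp |u| ≤ 2 * Real.cosh u := by
    rw [← Real.cosh_abs, Real.cosh_eq]; have := Real.exp_pos (-|u|); linarith
  have h3 : (2:ℝ) ≤ Real.exp 1 := by have := Real.add_one_le_exp (1:ℝ); linarith
  have hA := sxA_pos v
  rw [← Real.exp_le_exp, Real.exp_add, Real.exp_log hA, Real.exp_add]
  calc sxA v * Real.exp |u| ≤ sxA v * (2 * Real.cosh u) := by gcongr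
    _ = Real.cosh r * 2 := by rw [h]; ring
    _ ≤ _ := by gcongr

lemma sx_integral_bound (s T u0 : ℝ) (hs : 1 / 2 < s) (hs1 : s ≤ 1) :
    ∫⁻ x, (if dist (sxP x) (sxP (0, 0)) ≤ T ∧ dist (sxP x) (sxP (u0, 0)) ≤ T then
      ENNReal.ofReal (Real.exp ((s - 1) * (dist (sxP x) (sxP (0, 0)) + dist (sxP x) (sxP (u0, 0)))))
      else 0) ≤
    ENNReal.ofReal (Real.exp 1 * (2 / (2 * s - 1)) * Real.exp ((2 * s - 1) * (T + 1)) *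
      Real.exp (- |u0| / 2)) * ∫⁻ u : ℝ, ENNReal.ofReal (Real.exp (-(2 * s - 1) * |u|)) := by
  set c := 2 * s - 1 with hc
  have hc0 : 0 < c := by linarith
  have hm : ∀ u : ℝ, |u0| ≤ |u| + |u - u0| := by
    intro u
    have := abs_sub_abs_le_abs_sub u0 u
    rw [abs_sub_comm u0 u] at this; linarith
  have hA0 : sxA 0 = 1 := by simp [sxA]
  have hmax : ∀ u t : ℝ, |u| ≤ t → |u - u0| ≤ t → |u0| / 2 + |u - u0 / 2| ≤ t := by
    intro u t h1 h2
    rw [abs_le] at h1 h2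
    rcases abs_cases u0 with h | h <;> rcases abs_cases (u - u0 / 2) with h' | h' <;> linarith
  calc _ ≤ ∫⁻ x : ℝ × ℝ, ENNReal.ofReal (Real.exp (1 + (s - 1) * |u0|)) *
        (if sxA x.2 ≤ Real.exp (T + 1 - |u0| / 2 - |x.1 - u0 / 2|) then
          ENNReal.ofReal (sxA x.2 ^ (c - 1)) else 0) := by
        apply lintegral_mono
        rintro ⟨u, v⟩
        simp only
        split_ifs with h1 h2 h2
        · have b1 := sx_logbound u v _ dist_nonneg (by
            simpa [hA0] using sxP_cosh (u, v) (0, 0))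
          have b2 := sx_logbound (u - u0) v _ dist_nonneg (by
            simpa [hA0] using sxP_cosh (u, v) (u0, 0))
          rw [← ENNReal.ofReal_mul (Real.exp_pos _).le, Real.rpow_def_of_pos (sxA_pos v),
            ← Real.exp_add]
          apply ENNReal.ofReal_le_ofReal
          apply Real.exp_le_exp.mpr
          have := hm u
          nlinarith
        · exfalso
          apply h2
          have b1 := sx_logbound u v _ dist_nonneg (by
            simpa [hA0] using sxP_cosh (u, v) (0, 0))
          have b2 := sx_logbound (u - u0) v _ dist_nonneg (by
            simpa [hA0] using sxP_cosh (u, v) (u0, 0))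
          rw [← Real.log_le_iff_le_exp (sxA_pos v)]
          have := hmax u (T + 1 - Real.log (sxA v)) (by linarith [h1.1]) (by linarith [h1.2])
          linarith
        · exact zero_le
        · exact zero_le
    _ = ENNReal.ofReal (Real.exp (1 + (s - 1) * |u0|)) * ∫⁻ u, ∫⁻ v,
        (if sxA v ≤ Real.exp (T + 1 - |u0| / 2 - |u - u0 / 2|) then
          ENNReal.ofReal (sxA v ^ (c - 1)) else 0) := by
        rw [lintegral_const_mul' _ _ ENNReal.ofReal_ne_top, Measure.volume_eq_prod, lintegral_prod]
        apply Measurable.aemeasurable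
        have hA := sxA_cont.measurable
        apply Measurable.ite
        · apply measurableSet_le <;> fun_prop
        · fun_prop
        · fun_prop
    _ ≤ ENNReal.ofReal (Real.exp (1 + (s - 1) * |u0|)) * ∫⁻ u,
        ENNReal.ofReal (2 / c * Real.exp (c * (T + 1) - c * |u0| / 2)) *
          ENNReal.ofReal (Real.exp (-c * |u - u0 / 2|)) := by
        gcongr with u
        refine (sx_vint c _ hc0 (by linarith) (Real.exp_pos _).le).trans ?_
        rw [← ENNReal.ofReal_mul (by positivity), ← Real.exp_mul, mul_assoc, ← Real.exp_add]
        apply le_of_eq; congr 3; ring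
    _ = _ := by
        rw [lintegral_const_mul' _ _ ENNReal.ofReal_ne_top,
          lintegral_sub_right_eq_self (fun u => ENNReal.ofReal (Real.exp (-c * |u|))) (u0 / 2),
          ← mul_assoc, ← ENNReal.ofReal_mul (by positivity)]
        congr 2
        have e : Real.exp (1 + (s - 1) * |u0|) * Real.exp (c * (T + 1) - c * |u0| / 2) =
          Real.exp 1 * Real.exp (c * (T + 1)) * Real.exp (-|u0| / 2) := by
          rw [← Real.exp_add, ← Real.exp_add, ← Real.exp_add]
          congr 1; rw [hc]; ring
        linear_combination (2 / c) * e

lemma sx_Kfin (c : ℝ) (hc : 0 < c) : ∫⁻ u : ℝ, ENNReal.ofReal (Real.exp (-c * |u|)) ≠ ⊤ := by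
  have h : Integrable (fun u : ℝ => Real.exp (-c * |u|)) := by
    have h1 : IntegrableOn (fun u : ℝ => Real.exp (-c * |u|)) (Set.Ioi 0) :=
      (integrableOn_exp_mul_Ioi (a := -c) (by linarith) 0).congr_fun
        (fun u hu => by simp only [abs_of_pos (Set.mem_Ioi.mp hu)]) measurableSet_Ioi
    have h2 : IntegrableOn (fun u : ℝ => Real.exp (-c * |u|)) (Set.Iic 0) :=
      (integrableOn_exp_mul_Iic (a := c) hc 0).congr_fun
        (fun u hu => by simp only [abs_of_nonpos (Set.mem_Iic.mp hu)]; ring_nf) measurableSet_Iic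
    have := h2.union h1
    rwa [Set.Iic_union_Ioi, integrableOn_univ] at this
  have := h.hasFiniteIntegral
  rw [hasFiniteIntegral_iff_ofReal (Filter.Eventually.of_forall fun _ => (Real.exp_pos _).le)] at this
  exact this.ne

lemma sx_rot (z : ℍ) : ∃ k : SL(2, ℝ), k • I = I ∧ ∃ u0, k • z = sxP (u0, 0) := by
  obtain ⟨t, ht⟩ : ∃ t : ℝ, Real.cos t * Real.sin t * (1 - (z.re ^ 2 + z.im ^ 2)) +
      (Real.cos t ^ 2 - Real.sin t ^ 2) * z.re = 0 := by
    have hcont : Continuous fun t : ℝ => Real.cos t * Real.sin t * (1 - (z.re ^ 2 + z.im ^ 2)) +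
      (Real.cos t ^ 2 - Real.sin t ^ 2) * z.re := by fun_prop
    have := intermediate_value_univ 0 (Real.pi / 2) hcont
    have := intermediate_value_univ (Real.pi / 2) 0 hcont
    simp at *
    rcases le_total 0 z.re with h | h
    · exact this ⟨by linarith, h⟩
    · rename_i h'
      exact h' ⟨h, by linarith⟩
  obtain ⟨p, q, hcs, ht⟩ : ∃ p q : ℝ, q ^ 2 + p ^ 2 = 1 ∧
      p * q * (1 - (z.re ^ 2 + z.im ^ 2)) + (p ^ 2 - q ^ 2) * z.re = 0 :=
    ⟨_, _, Real.sin_sq_add_cos_sq t, ht⟩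
  let k : SL(2, ℝ) := ⟨!![p, q; -q, p], by
    rw [Matrix.det_fin_two_of]; nlinarith [hcs]⟩
  have hk : ∀ w : ℍ, ((k • w : ℍ) : ℂ) * (-q * w + p) =
      (p * w + q) := by
    intro w
    have := denom_ne_zero k w
    rw [coe_specialLinearGroup_apply]
    have e : denom k w = -q * w + p := by
      change ((-q : ℝ) : ℂ) * w + (p : ℂ) = _
      push_cast; rfl
    rw [e] at this
    simp only [k]
    simp at this ⊢
    rw [div_mul_cancel₀ _ this]
  refine ⟨k, ?_, ?_⟩
  · apply UpperHalfPlane.ext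
    have h := hk I
    have hne : (-q * (I : ℍ) + p : ℂ) ≠ 0 := by
      intro h0
      have a := congrArg Complex.re h0
      have b := congrArg Complex.im h0
      simp at a b
      have := hcs
      rw [a, b] at this; norm_num at this
    apply mul_right_cancel₀ hne
    rw [h]
    apply Complex.ext <;> simp
  · refine ⟨Real.log (k • z).im, ?_⟩
    have hre : (k • z).re = 0 := by
      have h := hk z
      have a := congrArg Complex.re h
      have b := congrArg Complex.im h
      simp at a b
      set X := (k • z).re
      set Y := (k • z).im
      have hD : 0 < (-(q * z.re) + p) ^ 2 + (q * z.im) ^ 2 := by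
        by_contra hh
        have h1 : -(q * z.re) + p = 0 := by nlinarith [sq_nonneg (-(q * z.re) + p), sq_nonneg (q * z.im)]
        have h2 : q * z.im = 0 := by nlinarith [sq_nonneg (-(q * z.re) + p), sq_nonneg (q * z.im)]
        have h3 : q = 0 := by simpa [z.im_pos.ne'] using h2
        rw [h3] at h1
        have := hcs
        simp at h1
        rw [h1, h3] at this; norm_num at this
      have : X * ((-(q * z.re) + p) ^ 2 + (q * z.im) ^ 2) = 0 := by
        linear_combination (-(q * z.re) + p) * a - (q * z.im) * b + ht
      rcases mul_eq_zero.mp this with h | h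
      · exact h
      · linarith
    apply UpperHalfPlane.ext
    apply Complex.ext
    · change (k • z).re = (sxP _).re
      rw [sxP_re, hre]; simp
    · change (k • z).im = (sxP _).im
      rw [sxP_im, Real.exp_log (k • z).im_pos]; simp [sxA]

lemma sx_meas : Measurable fun g : SL(2, ℝ) ↦ g • I :=
  sx_proper.continuous.measurable

lemma sx_fin (μ : Measure SL(2, ℝ)) [μ.IsHaarMeasure] :
    IsFiniteMeasureOnCompacts (μ.map (fun g : SL(2, ℝ) ↦ g • I)) := by
  refine ⟨fun K hK => ?_⟩
  rw [Measure.map_apply sx_meas hK.isClosed.measurableSet]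
  exact (sx_proper.isCompact_preimage hK).measure_lt_top

lemma sx_ball (μ : Measure SL(2, ℝ)) [μ.IsHaarMeasure] (z : ℍ) :
    (μ.map (fun g : SL(2, ℝ) ↦ g • I)) (Metric.closedBall z 3) =
    (μ.map (fun g : SL(2, ℝ) ↦ g • I)) (Metric.closedBall I 3) := by
  rw [Measure.map_apply sx_meas Metric.isClosed_closedBall.measurableSet,
    Measure.map_apply sx_meas Metric.isClosed_closedBall.measurableSet]
  rw [← measure_preimage_mul μ (z.toSL2R)]
  congr 1
  ext h
  simp only [Set.mem_preimage, Metric.mem_closedBall, mul_smul]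
  conv_lhs => rw [← toSL2R_smul_I z]
  simp only [toSL2R_smul_I z]
  rw [← dist_smul z.toSL2R (h • I) I, toSL2R_smul_I z]

theorem statement11 (μ : Measure SL(2, ℝ)) [μ.IsHaarMeasure]
    (s0 : ℝ) (hs0 : 1 / 2 < s0) (hs0' : s0 ≤ 1)
    (f : ℝ → SL(2, ℝ) → ℝ)
    (hf : ∀ T : ℝ, ∀ g : SL(2, ℝ),
      f T g = if dist (g • I) I ≤ T then Real.exp ((s0 - 1) * dist (g • I) I) else 0) :
    ∃ C : ℝ, 0 < C ∧
      ∀ T : ℝ, 1 ≤ T → ∀ g : SL(2, ℝ),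
        (∫ h, f T h * f T (g⁻¹ * h) ∂μ) ≤
            C * Real.exp ((2 * s0 - 1) * T) * Real.exp (-dist (g • I) I / 2) ∧
        (2 * T < dist (g • I) I → (∫ h, f T h * f T (g⁻¹ * h) ∂μ) = 0) := by
  set ν := μ.map (fun g : SL(2, ℝ) ↦ g • I) with hν
  have := sx_fin μ
  have hsf : SFinite ν := inferInstance
  set N := ν (Metric.closedBall I 3) with hN
  have hNt : N ≠ ⊤ := (isCompact_closedBall I 3).measure_lt_top.ne
  set K := ∫⁻ u : ℝ, ENNReal.ofReal (Real.exp (-(2 * s0 - 1) * |u|)) with hK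
  have hKt : K ≠ ⊤ := sx_Kfin _ (by linarith)
  have hc : 0 < 2 * s0 - 1 := by linarith
  have hdg : ∀ g h : SL(2, ℝ), dist ((g⁻¹ * h) • I) I = dist (h • I) (g • I) := by
    intro g h
    rw [← dist_smul g, mul_smul, smul_inv_smul]
  set C0 : ℝ := Real.exp (6 * (1 - s0)) * (Real.exp 1 * (2 / (2 * s0 - 1)) *
      Real.exp ((2 * s0 - 1) * 4)) with hC0
  have hC0p : 0 < C0 := by positivity
  refine ⟨N.toReal * K.toReal * C0 + 1, by positivity, fun T hT g => ⟨?_, fun hg => ?_⟩⟩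
  · obtain ⟨k, hkI, u0, hku⟩ := sx_rot (g • I)
    have hD : dist (g • I) I = |u0| := by
      have h1 : dist (g • I) I = dist (sxP (u0, 0)) (sxP (0, 0)) := by
        rw [← dist_smul k, hku, hkI, sxP_zero]
      have h2 := sxP_cosh (u0, 0) (0, 0)
      have hA0 : sxA 0 = 1 := by simp [sxA]
      simp only [hA0, sub_zero, mul_zero, one_mul] at h2
      rw [h1]
      have h3 := (Real.cosh_le_cosh.mp h2.le)
      have h4 := (Real.cosh_le_cosh.mp h2.ge)
      rw [abs_of_nonneg dist_nonneg] at h3 h4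
      linarith
    -- the function on the plane
    set F : ℍ → ℝ≥0∞ := fun z =>
      if dist z (sxP (0, 0)) ≤ T ∧ dist z (sxP (u0, 0)) ≤ T then
        ENNReal.ofReal (Real.exp ((s0 - 1) * (dist z (sxP (0, 0)) + dist z (sxP (u0, 0))))) else 0
      with hFdef
    set F' : ℍ → ℝ≥0∞ := fun z => ENNReal.ofReal (Real.exp (6 * (1 - s0))) *
      (if dist z (sxP (0, 0)) ≤ T + 3 ∧ dist z (sxP (u0, 0)) ≤ T + 3 then
        ENNReal.ofReal (Real.exp ((s0 - 1) * (dist z (sxP (0, 0)) + dist z (sxP (u0, 0))))) else 0)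
      with hFdef'
    have hFm : Measurable F := by
      have hd : ∀ w : ℍ, Measurable fun z : ℍ => dist z w := fun w =>
        measurable_id.dist measurable_const
      apply Measurable.ite
      · exact (measurableSet_le (hd _) measurable_const).inter
          (measurableSet_le (hd _) measurable_const)
      · fun_prop
      · fun_prop
    have hFF : ∀ z w, dist z w ≤ 3 → F z ≤ F' w := by
      intro z w hzw
      simp only [hFdef, hFdef']
      have a1 := dist_triangle w z (sxP (0, 0))
      have a2 := dist_triangle w z (sxP (u0, 0))
      rw [dist_comm w z] at a1 a2
      by_cases h : dist z (sxP (0, 0)) ≤ T ∧ dist z (sxP (u0, 0)) ≤ T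
      · rw [if_pos h, if_pos ⟨by linarith [h.1], by linarith [h.2]⟩,
          ← ENNReal.ofReal_mul (Real.exp_pos _).le, ← Real.exp_add]
        apply ENNReal.ofReal_le_ofReal
        apply Real.exp_le_exp.mpr
        nlinarith
      · rw [if_neg h]; exact zero_le
    have key : ∀ h : SL(2, ℝ), ‖f T (k⁻¹ * h) * f T (g⁻¹ * (k⁻¹ * h))‖ₑ = F (h • I) := by
      intro h
      have e1 : dist ((k⁻¹ * h) • I) I = dist (h • I) (sxP (0, 0)) := by
        rw [hdg, hkI, sxP_zero]
      have e2 : dist ((g⁻¹ * (k⁻¹ * h)) • I) I = dist (h • I) (sxP (u0, 0)) := by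
        rw [← mul_assoc, ← mul_inv_rev, hdg, mul_smul, hku]
      rw [hf, hf, e1, e2]
      simp only [hFdef]
      by_cases h1 : dist (h • I) (sxP (0, 0)) ≤ T <;>
        by_cases h2 : dist (h • I) (sxP (u0, 0)) ≤ T <;> simp only [h1, h2, if_true, if_false,
          and_true, and_false, mul_zero, zero_mul, enorm_zero]
      rw [← Real.exp_add, ← mul_add, Real.enorm_eq_ofReal (Real.exp_pos _).le]
    have main : ENNReal.ofReal (∫ h, f T h * f T (g⁻¹ * h) ∂μ) ≤ ENNReal.ofReal
        (N.toReal * K.toReal * C0 * Real.exp ((2 * s0 - 1) * T) * Real.exp (-|u0| / 2)) := by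
      calc _ ≤ ‖∫ h, f T h * f T (g⁻¹ * h) ∂μ‖ₑ := by
            rw [Real.enorm_eq_ofReal_abs]; exact ENNReal.ofReal_le_ofReal (le_abs_self _)
        _ = ‖∫ h, f T (k⁻¹ * h) * f T (g⁻¹ * (k⁻¹ * h)) ∂μ‖ₑ := by
            rw [integral_mul_left_eq_self (fun h => f T h * f T (g⁻¹ * h)) k⁻¹]
        _ ≤ ∫⁻ h, ‖f T (k⁻¹ * h) * f T (g⁻¹ * (k⁻¹ * h))‖ₑ ∂μ := enorm_integral_le_lintegral_enorm _
        _ = ∫⁻ h, F (h • I) ∂μ := lintegral_congr key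
        _ = ∫⁻ z, F z ∂ν := (lintegral_map hFm sx_meas).symm
        _ ≤ N * ∫⁻ x, F' (sxP x) := sx_compare ν N hNt (fun z => (sx_ball μ z).le) F F' hFm hFF
        _ ≤ N * (ENNReal.ofReal (Real.exp (6 * (1 - s0))) * (ENNReal.ofReal (Real.exp 1 * (2 / (2 * s0 - 1)) * Real.exp ((2 * s0 - 1) * (T + 3 + 1)) *
              Real.exp (- |u0| / 2)) * K)) := by
            simp only [hFdef']
            rw [lintegral_const_mul' _ _ ENNReal.ofReal_ne_top]
            gcongr
            exact sx_integral_bound s0 (T + 3) u0 hs0 hs0'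
        _ = _ := by
            rw [← ENNReal.ofReal_toReal hNt, ← ENNReal.ofReal_toReal hKt,
              ← ENNReal.ofReal_mul (by positivity), ← ENNReal.ofReal_mul (by positivity),
              ← ENNReal.ofReal_mul (by positivity), ENNReal.toReal_ofReal (by positivity),
              ENNReal.toReal_ofReal (by positivity)]
            congr 1
            rw [show (2 * s0 - 1) * (T + 3 + 1) = (2 * s0 - 1) * T + (2 * s0 - 1) * 4 by ring,
              Real.exp_add, hC0]
            ring
    rw [ENNReal.ofReal_le_ofReal_iff (by positivity)] at main
    rw [hD]
    refine main.trans ?_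
    gcongr
    linarith
  · have : ∀ h, f T h * f T (g⁻¹ * h) = 0 := by
      intro h
      rw [hf, hf, hdg]
      have := dist_triangle_left (g • I) I (h • I)
      by_cases h1 : dist (h • I) I ≤ T
      · rw [if_neg (c := dist (h • I) (g • I) ≤ T) (by intro h2; linarith), mul_zero]
      · rw [if_neg h1, zero_mul]
    simp [this]
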